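/- arXiv:2307.13020 — 2 statements merged into one kernel-verified Lean document; each statement's English description precedes it below -/
import Mathlib

section
/- Let (Ω, 𝓕, P) be a probability space, n ∈ ℕ, θ* ∈ ℝⁿ, and 𝓗_∞ an n×n real symmetric positive definite matrix. For each t > 0 let H_{1,t}, H_{2,t} : Ω → ℝⁿ be random vectors and [H]_{1,t}, [H]_{2,t} : Ω → M_n(ℝ) be random matrices. Assume: (i) ([H]_{1,t})⁻¹ H_{1,t} → θ* in P-probability as t → ∞; (ii) t⁻¹ [H]_{1,t} → 𝓗_∞ in P-probability as t → ∞; (iii) t^{−1/2} (H_{2,t} − H_{1,t}) → 0 in P-probability as t → ∞; (iv) t^{−1/2} ([H]_{2,t} − [H]_{1,t}) → 0 in P-probability as t → ∞. Then √t · ( ([H]_{2,t})⁻¹ H_{2,t} − ([H]_{1,t})⁻¹ H_{1,t} ) → 0 in P-probability as t → ∞. -/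
open MeasureTheory Filter ProbabilityTheory

attribute [local instance] Matrix.normedAddCommGroup

/-- The filter on `ι × Ω` of the sets whose slices at `i` have asymptotically null complement:
convergence in measure to a constant is ordinary convergence along this filter. -/
def inMeasureFilter {ι Ω : Type*} [MeasurableSpace Ω] (P : Measure Ω) (l : Filter ι) :
    Filter (ι × Ω) where
  sets := {S | Tendsto (fun i => P {ω | (i, ω) ∉ S}) l (nhds 0)}
  univ_sets := by simpa using tendsto_const_nhds
  sets_of_superset {S T} hS hST :=
    tendsto_of_tendsto_of_tendsto_of_le_of_le tendsto_const_nhds hS (fun _ => zero_le)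
      fun i => measure_mono fun ω hω h => hω (hST h)
  inter_sets {S T} hS hT := by
    have h : Tendsto (fun i => P {ω | (i, ω) ∉ S} + P {ω | (i, ω) ∉ T}) l (nhds 0) := by
      simpa using Tendsto.add hS hT
    refine tendsto_of_tendsto_of_tendsto_of_le_of_le tendsto_const_nhds h (fun _ => zero_le)
      fun i => (measure_mono fun ω hω => ?_).trans (measure_union_le _ _)
    exact not_and_or.1 hω

theorem tendsto_fst_inMeasureFilter {ι Ω : Type*} [MeasurableSpace Ω] (P : Measure Ω)
    (l : Filter ι) : Tendsto Prod.fst (inMeasureFilter P l) l := by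
  intro S hS
  refine tendsto_const_nhds.congr' ?_
  filter_upwards [hS] with i hi
  simp [hi]

theorem tendstoInMeasure_const_iff {ι Ω E : Type*} [MeasurableSpace Ω] [PseudoEMetricSpace E]
    {P : Measure Ω} {l : Filter ι} {f : ι → Ω → E} {a : E} :
    TendstoInMeasure P f l (fun _ => a) ↔
      Tendsto (fun x : ι × Ω => f x.1 x.2) (inMeasureFilter P l) (nhds a) := by
  rw [EMetric.tendsto_nhds]
  refine forall₂_congr fun ε _ => ?_
  change _ ↔ Tendsto (fun i => P {ω | ¬ edist (f i ω) a < ε}) l (nhds 0)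
  simp only [not_lt]

theorem tendsto_sqrt_smul_inv_mulVec_sub {α m : Type*} [Fintype m] [DecidableEq m]
    {l : Filter α} {τ : α → ℝ} {θ : m → ℝ} {M : Matrix m m ℝ} (hM : M.det ≠ 0)
    {H1 H2 : α → m → ℝ} {Q1 Q2 : α → Matrix m m ℝ} (hτ : Tendsto τ l atTop)
    (hθ : Tendsto (fun x => (Q1 x)⁻¹.mulVec (H1 x)) l (nhds θ))
    (hQ1 : Tendsto (fun x => (τ x)⁻¹ • Q1 x) l (nhds M))
    (hH : Tendsto (fun x => (√(τ x))⁻¹ • (H2 x - H1 x)) l (nhds 0))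
    (hQ : Tendsto (fun x => (√(τ x))⁻¹ • (Q2 x - Q1 x)) l (nhds 0)) :
    Tendsto (fun x => √(τ x) • ((Q2 x)⁻¹.mulVec (H2 x) - (Q1 x)⁻¹.mulVec (H1 x))) l
      (nhds 0) := by
  have hs : Tendsto (fun x => (√(τ x))⁻¹) l (nhds 0) :=
    tendsto_inv_atTop_zero.comp (Real.tendsto_sqrt_atTop.comp hτ)
  have hpos : ∀ᶠ x in l, 0 < τ x := hτ.eventually_gt_atTop 0
  have hB : Tendsto (fun x => (τ x)⁻¹ • Q2 x) l (nhds M) := by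
    have h := hQ1.add (hs.smul hQ)
    rw [smul_zero, add_zero] at h
    refine h.congr' ?_
    filter_upwards [hpos] with x hx
    rw [smul_smul, ← mul_inv, Real.mul_self_sqrt hx.le, smul_sub, add_sub_cancel]
  have hdet : Continuous fun A : Matrix m m ℝ => A.det := continuous_id.matrix_det
  have hdet1 := ((hdet.tendsto M).comp hQ1).eventually_ne hM
  have hdet2 := ((hdet.tendsto M).comp hB).eventually_ne hM
  have hinv : Tendsto (fun x => ((τ x)⁻¹ • Q2 x)⁻¹) l (nhds M⁻¹) := by
    simp only [Matrix.inv_def, Ring.inverse_eq_inv']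
    exact (((hdet.tendsto M).comp hB).inv₀ hM).smul
      (((continuous_id.matrix_adjugate).tendsto M).comp hB)
  have hmulVec {A : α → Matrix m m ℝ} {v : α → m → ℝ} {A₀ v₀} (hA : Tendsto A l (nhds A₀))
      (hv : Tendsto v l (nhds v₀)) :
      Tendsto (fun x => (A x).mulVec (v x)) l (nhds (A₀.mulVec v₀)) :=
    ((continuous_fst.matrix_mulVec continuous_snd).tendsto (A₀, v₀)).comp (hA.prodMk_nhds hv)
  have key := hmulVec hinv (hH.sub (hmulVec hQ hθ))
  simp only [Matrix.zero_mulVec, sub_zero, Matrix.mulVec_zero] at key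
  refine key.congr' ?_
  filter_upwards [hpos, hdet1, hdet2] with x hx h1 h2
  have hsq := Real.mul_self_sqrt hx.le
  have hs0 : √(τ x) ≠ 0 := (Real.sqrt_pos.2 hx).ne'
  simp only [Function.comp_apply, Matrix.det_smul] at h1 h2
  have u1 : IsUnit (Q1 x).det := (right_ne_zero_of_mul h1).isUnit
  have u2 : IsUnit (Q2 x).det := (right_ne_zero_of_mul h2).isUnit
  have hinv2 : ((τ x)⁻¹ • Q2 x)⁻¹ = τ x • (Q2 x)⁻¹ := by
    refine Matrix.inv_eq_right_inv ?_
    rw [smul_mul_smul_comm, inv_mul_cancel₀ hx.ne', one_smul, Matrix.mul_nonsing_inv _ u2]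
  have hQ1H : (Q1 x).mulVec ((Q1 x)⁻¹.mulVec (H1 x)) = H1 x := by
    rw [Matrix.mulVec_mulVec, Matrix.mul_nonsing_inv _ u1, Matrix.one_mulVec]
  have hQ2v (v : m → ℝ) : (Q2 x)⁻¹.mulVec ((Q2 x).mulVec v) = v := by
    rw [Matrix.mulVec_mulVec, Matrix.nonsing_inv_mul _ u2, Matrix.one_mulVec]
  have hc : τ x * (√(τ x))⁻¹ = √(τ x) := by
    rw [← div_eq_mul_inv, div_eq_iff hs0, hsq]
  rw [hinv2, Matrix.smul_mulVec, Matrix.smul_mulVec, ← smul_sub, Matrix.mulVec_smul, smul_smul, hc,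
    Matrix.sub_mulVec, hQ1H, sub_sub_sub_cancel_right, Matrix.mulVec_sub, hQ2v]

/-- Slutsky-type transfer step (paper's Lemma 4.2, Equation (4.6)):
`√t (([H]_{2,t})⁻¹ H_{2,t} − ([H]_{1,t})⁻¹ H_{1,t}) → 0` in probability. -/
theorem stmt12 {Ω : Type*} [MeasurableSpace Ω] (P : Measure Ω) [IsProbabilityMeasure P]
    (n : ℕ) (θ : Fin n → ℝ) (Hinf : Matrix (Fin n) (Fin n) ℝ) (hHinf : Hinf.PosDef)
    (H1 H2 : ℝ → Ω → (Fin n → ℝ))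
    (Q1 Q2 : ℝ → Ω → Matrix (Fin n) (Fin n) ℝ)
    (hcons : TendstoInMeasure P (fun t ω => (Q1 t ω)⁻¹.mulVec (H1 t ω)) atTop fun _ => θ)
    (hQ1 : TendstoInMeasure P (fun t ω => t⁻¹ • Q1 t ω) atTop fun _ => Hinf)
    (hHdiff : TendstoInMeasure P (fun t ω => (Real.sqrt t)⁻¹ • (H2 t ω - H1 t ω)) atTop
      fun _ => (0 : Fin n → ℝ))
    (hQdiff : TendstoInMeasure P (fun t ω => (Real.sqrt t)⁻¹ • (Q2 t ω - Q1 t ω)) atTop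
      fun _ => (0 : Matrix (Fin n) (Fin n) ℝ)) :
    TendstoInMeasure P
      (fun t ω => Real.sqrt t •
        ((Q2 t ω)⁻¹.mulVec (H2 t ω) - (Q1 t ω)⁻¹.mulVec (H1 t ω))) atTop
      fun _ => (0 : Fin n → ℝ) := by
  rw [tendstoInMeasure_const_iff] at *
  exact tendsto_sqrt_smul_inv_mulVec_sub hHinf.det_pos.ne' (tendsto_fst_inMeasureFilter P atTop)
    hcons hQ1 hHdiff hQdiff
end

section
/- Fix β > 0. Then the function s ↦ (1/Γ(s)) · ∫₀^{s^β} x^s e^{−x} dx is O(s^{1+β}) as s → 0⁺; that is, there exist constants C > 0 and s₀ > 0 such that for all s ∈ (0, s₀), (1/Γ(s)) · ∫₀^{s^β} x^s e^{−x} dx ≤ C · s^{1+β}. -/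
theorem exists_forall_one_half_lt_Gamma_add_one :
    ∃ δ : ℝ, 0 < δ ∧ ∀ s : ℝ, 0 < s → s < δ → 1 / 2 < Real.Gamma (s + 1) := by
  have hc : ContinuousAt Real.Gamma 1 :=
    (Real.differentiableAt_Gamma fun m h => by linarith [m.cast_nonneg (α := ℝ)]).continuousAt
  have hev : ∀ᶠ x in nhds (1 : ℝ), 1 / 2 < Real.Gamma x :=
    hc.eventually (lt_mem_nhds (by rw [Real.Gamma_one]; norm_num))
  obtain ⟨δ, hδ, h⟩ := Metric.eventually_nhds_iff.1 hev
  refine ⟨δ, hδ, fun s hs hsδ => h ?_⟩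
  rwa [Real.dist_eq, add_sub_cancel_right, abs_of_pos hs]

theorem integral_rpow_mul_exp_neg_le {s b : ℝ} (hs : 0 ≤ s) (hb : 0 ≤ b) (hb' : b ≤ 1) :
    ∫ x in (0 : ℝ)..b, x ^ s * Real.exp (-x) ≤ b := by
  have h : ∫ x in (0 : ℝ)..b, x ^ s * Real.exp (-x) ≤ ∫ _ in (0 : ℝ)..b, (1 : ℝ) := by
    refine intervalIntegral.integral_mono_on hb ?_ intervalIntegrable_const fun x hx => ?_
    · exact ((Real.continuous_rpow_const hs).mul
        (Real.continuous_exp.comp continuous_neg)).intervalIntegrable _ _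
    · exact mul_le_one₀ (Real.rpow_le_one hx.1 (hx.2.trans hb') hs) (Real.exp_pos _).le
        (Real.exp_le_one_iff.2 (neg_nonpos.2 hx.1))
  simpa using h

/-- For a standard Gamma process, the truncated first moment
`E[|M_s| 1_{|M_s| ≤ s^β}] = (1/Γ(s)) ∫₀^{s^β} x^s e^{−x} dx` is `O(s^{1+β})` as `s → 0⁺`. -/
theorem stmt15 (β : ℝ) (hβ : 0 < β) :
    ∃ C : ℝ, 0 < C ∧ ∃ s₀ : ℝ, 0 < s₀ ∧ ∀ s : ℝ, 0 < s → s < s₀ →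
      (1 / Real.Gamma s) * ∫ x in (0 : ℝ)..(s ^ β), x ^ s * Real.exp (-x) ≤
        C * s ^ (1 + β) := by
  obtain ⟨δ, hδ, hΓ⟩ := exists_forall_one_half_lt_Gamma_add_one
  refine ⟨2, two_pos, min δ 1, lt_min hδ one_pos, fun s hs hs' => ?_⟩
  have hsβ : 0 ≤ s ^ β := Real.rpow_nonneg hs.le β
  have hsβ' : s ^ β ≤ 1 :=
    Real.rpow_le_one hs.le (hs'.trans_le (min_le_right _ _)).le hβ.le
  have hΓs : 0 < Real.Gamma s := Real.Gamma_pos_of_pos hs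
  have hinv : 1 / Real.Gamma s ≤ 2 * s := by
    have h := hΓ s hs (hs'.trans_le (min_le_left _ _))
    rw [Real.Gamma_add_one hs.ne'] at h
    rw [div_le_iff₀ hΓs]
    linarith
  calc (1 / Real.Gamma s) * ∫ x in (0 : ℝ)..(s ^ β), x ^ s * Real.exp (-x)
      ≤ (1 / Real.Gamma s) * s ^ β := by
        gcongr
        exact integral_rpow_mul_exp_neg_le hs.le hsβ hsβ'
    _ ≤ 2 * s * s ^ β := by gcongr
    _ = 2 * s ^ (1 + β) := by rw [Real.rpow_add hs, Real.rpow_one, mul_assoc]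
end
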